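/- arXiv:1504.04966 — 2 statements merged into one kernel-verified Lean document; each statement's English description precedes it below -/
import Mathlib

section
/- Bowen–Franks data of the Fischer cover of a sofic beta-shift: let β > 1 have eventually periodic generating sequence g(β), with n ≥ 0 and p ≥ 1 minimal such that g(β) = g_1 ⋯ g_n (g_{n+1} ⋯ g_{n+p})^∞, and set S = g_{n+1} + ⋯ + g_{n+p}. Let A_F be the (n+p) × (n+p) integer matrix whose entries are all 0 except: the first column receives (A_F)_{i,1} += g_i for every 1 ≤ i ≤ n+p, the superdiagonal receives (A_F)_{i,i+1} += 1 for 1 ≤ i ≤ n+p−1, and (A_F)_{n+p,n+1} += 1. Then ℤ^{n+p} / { v·(I − A_F) : v ∈ ℤ^{n+p} } is isomorphic as an abelian group to ℤ/Sℤ, and det(I − A_F) = −S. -/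
/-- The remainders `r_n(t)` of the β-expansion of `t` (0-indexed: `betaRem β t n = r_n(t)`). -/
noncomputable def betaRem (β t : ℝ) : ℕ → ℝ
  | 0 => t
  | n + 1 => Int.fract (β * betaRem β t n)

/-- `betaDigit β t n` is the digit `x_{n+1}(t)` of the β-expansion of `t` (0-indexed). -/
noncomputable def betaDigit (β t : ℝ) (n : ℕ) : ℕ :=
  (⌊β * betaRem β t n⌋).toNat

/- The generating sequence `g(β)`, 0-indexed: `genSeq β i = g_{i+1}`.
If `e(β)` is eventually zero with last nonzero digit at (0-indexed) position `k`,
then `g(β)` is the periodic sequence of period `k+1` obtained from the initial word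
of `e(β)` of length `k+1` by decreasing its last letter by one; otherwise `g(β) = e(β)`. -/
open scoped Classical in
noncomputable def genSeq (β : ℝ) : ℕ → ℕ :=
  if h : ∃ k, betaDigit β 1 k ≠ 0 ∧ ∀ m, k < m → betaDigit β 1 m = 0 then
    fun i =>
      if i % (Nat.find h + 1) = Nat.find h then betaDigit β 1 (Nat.find h) - 1
      else betaDigit β 1 (i % (Nat.find h + 1))
  else
    betaDigit β 1

/-- Strict lexicographic order on one-sided sequences. -/
def lexLt (x y : ℕ → ℕ) : Prop :=
  ∃ n, (∀ i < n, x i = y i) ∧ x n < y n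

/-- Lexicographic order on one-sided sequences. -/
def lexLe (x y : ℕ → ℕ) : Prop :=
  x = y ∨ lexLt x y

/-- Membership in the beta-shift `X_β` (bi-infinite sequences). -/
def memBeta (β : ℝ) (x : ℤ → ℕ) : Prop :=
  ∀ k : ℤ, lexLe (fun n : ℕ => x (k + n)) (genSeq β)

/-- Membership in the right-ray space `X_β⁺`. -/
def rightRay (β : ℝ) (x : ℕ → ℕ) : Prop :=
  ∀ k : ℕ, lexLe (fun n : ℕ => x (k + n)) (genSeq β)

/-- The matrix `I - A` with first column `-g`, superdiagonal `-1` and an extra `-1` in position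
`(m, n)`, for an arbitrary weight sequence `g`. -/
def coverMatrix (g : ℕ → ℤ) (m n : ℕ) : Matrix (Fin (m + 1)) (Fin (m + 1)) ℤ :=
  Matrix.of fun i j =>
    (if i = j then 1 else 0) - ((if (j : ℕ) = 0 then g i else 0)
      + (if (j : ℕ) = (i : ℕ) + 1 then 1 else 0)
      + (if (i : ℕ) = m ∧ (j : ℕ) = n then 1 else 0))

/-- The coefficient of the `k`-th basis vector in terms of the zeroth one modulo the row lattice. -/
def coverWeight (g : ℕ → ℤ) (k : ℕ) : ℤ := 1 - ∑ i ∈ Finset.range k, g i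

theorem coverMatrix_mulVec_castSucc (g : ℕ → ℤ) (m n : ℕ) (i : Fin m) :
    ∑ j : Fin (m + 1), coverWeight g j * coverMatrix g m n i.castSucc j = 0 := by
  have h1 : ∀ j : Fin (m + 1), coverWeight g j * coverMatrix g m n i.castSucc j =
      (if i.castSucc = j then coverWeight g j else 0)
        - (if 0 = j then coverWeight g j * g i else 0)
        - (if i.succ = j then coverWeight g j else 0) := by
    intro j
    have := i.2
    simp only [coverMatrix, Matrix.of_apply, Fin.ext_iff, Fin.val_castSucc, Fin.val_succ,
      Fin.val_zero]
    split_ifs <;> first | contradiction | omega | ring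
  simp only [h1, Finset.sum_sub_distrib, Finset.sum_ite_eq, Finset.mem_univ, if_true]
  simp [coverWeight, Finset.sum_range_succ]
  ring

theorem coverMatrix_mulVec_last (g : ℕ → ℤ) (m n : ℕ) (hn : n ≤ m) :
    ∑ j : Fin (m + 1), coverWeight g j * coverMatrix g m n (Fin.last m) j
      = -∑ i ∈ Finset.Ico n (m + 1), g i := by
  have h1 : ∀ j : Fin (m + 1), coverWeight g j * coverMatrix g m n (Fin.last m) j =
      (if Fin.last m = j then coverWeight g j else 0)
        - (if 0 = j then coverWeight g j * g m else 0)
        - (if (⟨n, by omega⟩ : Fin (m + 1)) = j then coverWeight g j else 0) := by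
    intro j
    have := j.2
    simp only [coverMatrix, Matrix.of_apply, Fin.ext_iff, Fin.val_last, Fin.val_zero, true_and]
    split_ifs <;> first | contradiction | omega | ring
  simp only [h1, Finset.sum_sub_distrib, Finset.sum_ite_eq, Finset.mem_univ, if_true]
  rw [Finset.sum_Ico_eq_sub _ (by omega)]
  simp [coverWeight, Finset.sum_range_succ]
  ring

theorem vecMul_coverMatrix_succ (g : ℕ → ℤ) (m n : ℕ) (u : ℕ → ℤ) (j : Fin m) :
    ∑ i : Fin (m + 1), u i * coverMatrix g m n i j.succ
      = u (j + 1) - u j - (if (j : ℕ) + 1 = n then u m else 0) := by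
  have h1 : ∀ i : Fin (m + 1), u i * coverMatrix g m n i j.succ =
      (if j.succ = i then u i else 0) - (if j.castSucc = i then u i else 0)
        - (if Fin.last m = i then (if (j : ℕ) + 1 = n then u i else 0) else 0) := by
    intro i
    have := i.2
    simp only [coverMatrix, Matrix.of_apply, Fin.ext_iff, Fin.val_last, Fin.val_succ,
      Fin.val_castSucc]
    split_ifs <;> first | contradiction | omega
  simp only [h1, Finset.sum_sub_distrib, Finset.sum_ite_eq, Finset.mem_univ, if_true]
  simp

theorem sum_vecMul_coverMatrix (g : ℕ → ℤ) (m n : ℕ) (hn : n ≤ m) (u : Fin (m + 1) → ℤ) :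
    ∑ j : Fin (m + 1), coverWeight g j * ∑ i, u i * coverMatrix g m n i j
      = -(u (Fin.last m) * ∑ i ∈ Finset.Ico n (m + 1), g i) := by
  calc _ = ∑ i, u i * ∑ j : Fin (m + 1), coverWeight g j * coverMatrix g m n i j := by
        simp_rw [Finset.mul_sum]
        rw [Finset.sum_comm]
        refine Finset.sum_congr rfl fun i _ => Finset.sum_congr rfl fun j _ => by ring
    _ = _ := by
        rw [Fin.sum_univ_castSucc]
        simp [coverMatrix_mulVec_castSucc, coverMatrix_mulVec_last g m n hn]

theorem det_coverMatrix (g : ℕ → ℤ) (m n : ℕ) (hn : n ≤ m) :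
    (coverMatrix g m n).det = -∑ i ∈ Finset.Ico n (m + 1), g i := by
  have h := Matrix.det_updateCol_sum (coverMatrix g m n) 0 (fun j => coverWeight g j)
  have hw : coverWeight g ((0 : Fin (m + 1)) : ℕ) = 1 := by simp [coverWeight]
  rw [hw, one_smul] at h
  rw [← h, Matrix.det_succ_column_zero, Fin.sum_univ_castSucc]
  simp only [Matrix.updateCol_self, smul_eq_mul, coverMatrix_mulVec_castSucc,
    coverMatrix_mulVec_last g m n hn]
  have hsub : (((coverMatrix g m n).updateCol 0
      (fun k => ∑ i : Fin (m + 1), coverWeight g i * coverMatrix g m n k i)).submatrix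
        (Fin.last m).succAbove Fin.succ).det = (-1) ^ m := by
    have hentry : ∀ i j : Fin m, (((coverMatrix g m n).updateCol 0
        (fun k => ∑ i : Fin (m + 1), coverWeight g i * coverMatrix g m n k i)).submatrix
          (Fin.last m).succAbove Fin.succ) i j
            = (if (i : ℕ) = j + 1 then 1 else 0) - (if (j : ℕ) = i then 1 else 0) := by
      intro i j
      have := i.2
      rw [Matrix.submatrix_apply, Matrix.updateCol_ne (Fin.succ_ne_zero j)]
      simp only [coverMatrix, Matrix.of_apply, Fin.ext_iff, Fin.val_succ, Fin.val_castSucc,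
        Fin.succAbove_last]
      split_ifs <;> first | contradiction | omega
    rw [Matrix.det_of_isLowerTriangular]
    · simp only [hentry]
      simp
    · intro i j hij
      have hlt : (i : ℕ) < j := hij
      rw [hentry, if_neg (by omega), if_neg (by omega), sub_zero]
  rw [hsub]
  have hsq : ((-1 : ℤ) ^ m) * (-1) ^ m = 1 := by rw [← mul_pow]; simp
  simp only [mul_zero, zero_mul, Finset.sum_const_zero, zero_add, Fin.val_last]
  linear_combination (-∑ i ∈ Finset.Ico n (m + 1), g i) * hsq

theorem mem_range_vecMul_coverMatrix (g : ℕ → ℤ) (m n : ℕ) (hn : n ≤ m)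
    (v : Fin (m + 1) → ℤ) :
    v ∈ LinearMap.range (Matrix.vecMulLinear (coverMatrix g m n)) ↔
      (∑ i ∈ Finset.Ico n (m + 1), g i) ∣ ∑ j : Fin (m + 1), coverWeight g j * v j := by
  constructor
  · rintro ⟨u, rfl⟩
    simp only [Matrix.vecMulLinear_apply, Matrix.vecMul, dotProduct]
    rw [sum_vecMul_coverMatrix g m n hn]
    exact (Dvd.intro_left _ rfl).neg_right
  · rintro ⟨c, hc⟩
    let v' : ℕ → ℤ := fun k => if h : k < m + 1 then v ⟨k, h⟩ else 0
    let u : ℕ → ℤ := fun j =>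
      -c - ∑ k ∈ Finset.Ico (j + 1) (m + 1), (v' k + if k = n then -c else 0)
    have hum : u m = -c := by simp [u]
    have hsucc : ∀ j : Fin m, ∑ i : Fin (m + 1), u i * coverMatrix g m n i j.succ = v j.succ := by
      intro j
      have hj := j.2
      have hv : v' (j + 1) = v j.succ := dif_pos (by omega)
      rw [vecMul_coverMatrix_succ, hum, ← hv]
      simp only [u]
      rw [Finset.sum_eq_sum_Ico_succ_bot (show (j : ℕ) + 1 < m + 1 by omega)]
      ring
    have hsum := sum_vecMul_coverMatrix g m n hn (fun i => u i)
    simp only [Fin.val_last] at hsum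
    rw [hum] at hsum
    rw [Fin.sum_univ_succ] at hsum hc
    simp only [hsucc] at hsum
    have hw : coverWeight g ((0 : Fin (m + 1)) : ℕ) = 1 := by simp [coverWeight]
    rw [hw, one_mul] at hsum hc
    refine ⟨fun i => u i, funext fun j => ?_⟩
    simp only [Matrix.vecMulLinear_apply, Matrix.vecMul, dotProduct]
    refine Fin.cases ?_ hsucc j
    linear_combination hsum - hc

theorem nonempty_quotient_coverMatrix_addEquiv (g : ℕ → ℤ) (m n : ℕ) (hn : n ≤ m) (S : ℕ)
    (hS : (S : ℤ) = ∑ i ∈ Finset.Ico n (m + 1), g i) :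
    Nonempty (((Fin (m + 1) → ℤ) ⧸
      LinearMap.range (Matrix.vecMulLinear (coverMatrix g m n))) ≃+ ZMod S) := by
  let φ : (Fin (m + 1) → ℤ) →ₗ[ℤ] ZMod S :=
    (Int.castAddHom (ZMod S)).toIntLinearMap ∘ₗ
      Fintype.linearCombination ℤ (fun j : Fin (m + 1) => coverWeight g j)
  have hφ : ∀ v, φ v = ((∑ j : Fin (m + 1), coverWeight g j * v j : ℤ) : ZMod S) := by
    intro v
    simp [φ, Fintype.linearCombination_apply, mul_comm]
  have hsurj : Function.Surjective φ := by
    intro z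
    obtain ⟨c, rfl⟩ := ZMod.intCast_surjective z
    refine ⟨Pi.single 0 c, ?_⟩
    rw [hφ, Finset.sum_eq_single 0 (fun j _ hj => by simp [hj]) (by simp)]
    simp [coverWeight]
  have hker : LinearMap.range (Matrix.vecMulLinear (coverMatrix g m n)) = LinearMap.ker φ := by
    ext v
    rw [mem_range_vecMul_coverMatrix g m n hn, LinearMap.mem_ker, hφ,
      ZMod.intCast_zmod_eq_zero_iff_dvd, hS]
  exact ⟨((Submodule.quotEquivOfEq _ _ hker).trans
    (φ.quotKerEquivOfSurjective hsurj)).toAddEquiv⟩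

/-- Bowen–Franks data of the Fischer cover of a sofic beta-shift: with
minimal `n ≥ 0`, `p ≥ 1` such that `g(β) = g_1 ⋯ g_n (g_{n+1} ⋯ g_{n+p})^∞` and
`S = g_{n+1} + ⋯ + g_{n+p}`, if `A_F` is the adjacency matrix of the Fischer cover then
`ℤ^{n+p} / ℤ^{n+p}(I − A_F) ≅ ℤ/Sℤ` and `det(I − A_F) = −S`. -/
theorem statement15 (β : ℝ) (hβ : 1 < β) (n p : ℕ) (hp : 1 ≤ p)
    (hper : ∀ k, n ≤ k → genSeq β (k + p) = genSeq β k)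
    (hmin : ∀ n' p' : ℕ, 1 ≤ p' →
      (∀ k, n' ≤ k → genSeq β (k + p') = genSeq β k) → n ≤ n' ∧ p ≤ p')
    (S : ℕ) (hS : S = ∑ i ∈ Finset.range p, genSeq β (n + i))
    (A : Matrix (Fin (n + p)) (Fin (n + p)) ℤ)
    (hA : ∀ i j : Fin (n + p), A i j =
      (if (j : ℕ) = 0 then (genSeq β (i : ℕ) : ℤ) else 0)
      + (if (j : ℕ) = (i : ℕ) + 1 then 1 else 0)
      + (if (i : ℕ) = n + p - 1 ∧ (j : ℕ) = n then 1 else 0)) :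
    Nonempty (((Fin (n + p) → ℤ) ⧸
        LinearMap.range (Matrix.vecMulLinear (1 - A))) ≃+ ZMod S) ∧
      (1 - A).det = -(S : ℤ) := by
  obtain ⟨q, rfl⟩ : ∃ q, p = q + 1 := ⟨p - 1, by omega⟩
  have hM : 1 - A = coverMatrix (fun i => (genSeq β i : ℤ)) (n + q) n := by
    ext i j
    rw [Matrix.sub_apply, hA, Matrix.one_apply]
    rfl
  have hS' : (S : ℤ) = ∑ i ∈ Finset.Ico n (n + q + 1), (genSeq β i : ℤ) := by
    rw [hS, Finset.sum_Ico_eq_sum_range, show n + q + 1 - n = q + 1 by omega]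
    push_cast
    rfl
  rw [hM, hS']
  exact ⟨nonempty_quotient_coverMatrix_addEquiv _ _ _ (Nat.le_add_right n q) S hS',
    det_coverMatrix _ _ _ (Nat.le_add_right n q)⟩
end

section
/- For every β > 1 there exists β' with 1 < β' < 2 such that g(β') = φ(g(β)), where φ(g(β)) is the {0,1}-valued sequence 1^{g_1}0 · 1^{g_2}0 · 1^{g_3}0 ⋯ obtained by concatenating the blocks 1^{g_i}0 over the entries g_1 g_2 ⋯ of the generating sequence g(β). -/
/-- Starting position of the `i`-th block `1^{x_i}0` in the concatenation `φ(x)`. -/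
def blockStart (x : ℕ → ℕ) (i : ℕ) : ℕ :=
  ∑ j ∈ Finset.range i, (x j + 1)

/- The block-substitution map `φ`: the sequence obtained by concatenating
`1^{x_0}0 · 1^{x_1}0 · 1^{x_2}0 ⋯`.  Position `m` carries a `0` exactly when it is the
final letter of some block. -/
open scoped Classical in
noncomputable def phi (x : ℕ → ℕ) (m : ℕ) : ℕ :=
  if ∃ i, blockStart x i + x i = m then 0 else 1

section QuasiGreedy

variable {β : ℝ} {s : ℕ → ℝ} {d : ℕ → ℕ}

lemma sub_eq_pow_mul_sub_of_digits_eq (hs : ∀ n, s (n + 1) = β * s n - d n) {a b j : ℕ}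
    (h : ∀ i < j, d (a + i) = d (b + i)) :
    s (a + j) - s (b + j) = β ^ j * (s a - s b) := by
  induction j with
  | zero => simp
  | succ j ih =>
    rw [← add_assoc, ← add_assoc, hs, hs, h j (Nat.lt_succ_self j), pow_succ']
    linear_combination β * ih fun i hi => h i (hi.trans (Nat.lt_succ_self j))

lemma exists_digit_ne_zero (hβ : 1 < β) (hpos : ∀ n, 0 < s n) (hle : ∀ n, s n ≤ 1)
    (hs : ∀ n, s (n + 1) = β * s n - d n) (N : ℕ) : ∃ n ≥ N, d n ≠ 0 := by
  by_contra! h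
  have hpow (j : ℕ) : s (N + j) = β ^ j * s N := by
    induction j with
    | zero => simp
    | succ j ih => rw [← add_assoc, hs, h _ (Nat.le_add_right N j), ih, pow_succ']; simp [mul_assoc]
  obtain ⟨j, hj⟩ := pow_unbounded_of_one_lt (1 / s N) hβ
  rw [div_lt_iff₀ (hpos N), ← hpow] at hj
  exact absurd (hle (N + j)) (not_le.mpr hj)

lemma digit_le_of_le (hβ : 1 < β) (hpos : ∀ n, 0 < s n) (hle : ∀ n, s n ≤ 1)
    (hs : ∀ n, s (n + 1) = β * s n - d n) {a b : ℕ} (h : s a ≤ s b) : d a ≤ d b := by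
  have hmul : β * s a ≤ β * s b := mul_le_mul_of_nonneg_left h (by linarith)
  have hlt : (d a : ℝ) < d b + 1 := by
    linarith [hpos (a + 1), hle (b + 1), hs a, hs b]
  exact Nat.lt_succ_iff.mp (by exact_mod_cast hlt)

lemma lexLe_shift_of_remainders (hβ : 1 < β) (h0 : s 0 = 1) (hpos : ∀ n, 0 < s n)
    (hle : ∀ n, s n ≤ 1) (hs : ∀ n, s (n + 1) = β * s n - d n) (k : ℕ) :
    lexLe (fun n => d (k + n)) d := by
  classical
  by_cases hd : ∀ n, d (k + n) = d n
  · exact Or.inl (funext hd)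
  push Not at hd
  have hmin (i : ℕ) (hi : i < Nat.find hd) : d (k + i) = d i := not_not.mp (Nat.find_min hd hi)
  refine Or.inr ⟨Nat.find hd, hmin, lt_of_le_of_ne ?_ (Nat.find_spec hd)⟩
  apply digit_le_of_le hβ hpos hle hs
  have hsub := sub_eq_pow_mul_sub_of_digits_eq hs (a := k) (b := 0) (j := Nat.find hd)
    (by simpa using hmin)
  rw [h0, zero_add] at hsub
  have hpow : 0 < β ^ Nat.find hd := pow_pos (by linarith) _
  nlinarith [hle k]

lemma remainder_le_one (hβ : 1 < β) (h0 : s 0 = 1) (hnonneg : ∀ n, 0 ≤ s n) {M : ℝ}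
    (hM : ∀ n, s n ≤ M) (hs : ∀ n, s (n + 1) = β * s n - d n)
    (hd : ∀ k, lexLe (fun n => d (k + n)) d) (n : ℕ) : s n ≤ 1 := by
  have hstep (n : ℕ) (hn : 1 < s n) : ∃ m, β * (s n - 1) ≤ s m - 1 := by
    rcases hd n with heq | ⟨j, heq, hlt⟩
    · obtain ⟨j, hj⟩ := pow_unbounded_of_one_lt (M / (s n - 1)) hβ
      rw [div_lt_iff₀ (by linarith)] at hj
      have hsub := sub_eq_pow_mul_sub_of_digits_eq hs (a := n) (b := 0) (j := j)
        (fun i _ => by simpa using congrFun heq i)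
      rw [h0] at hsub
      linarith [hM (n + j), hnonneg (0 + j)]
    · refine ⟨n + j + 1, ?_⟩
      have hsub := sub_eq_pow_mul_sub_of_digits_eq hs (a := n) (b := 0) (j := j)
        (by simpa using heq)
      rw [h0, zero_add] at hsub
      have hlt' : (d (n + j) : ℝ) + 1 ≤ d j := by exact_mod_cast hlt
      have hpow : 1 ≤ β ^ j := one_le_pow₀ hβ.le
      have hmul : s n - 1 ≤ β ^ j * (s n - 1) := le_mul_of_one_le_left (by linarith) hpow
      have hmul' : β * (s n - 1) ≤ β * (s (n + j) - s j) := by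
        rw [hsub]; exact mul_le_mul_of_nonneg_left hmul (by linarith)
      linarith [hs (n + j), hs j, hnonneg (j + 1)]
  by_contra! hn
  have hiter (j : ℕ) : ∃ m, β ^ j * (s n - 1) ≤ s m - 1 := by
    induction j with
    | zero => exact ⟨n, by simp⟩
    | succ j ih =>
      obtain ⟨m, hm⟩ := ih
      have hpos : 0 < β ^ j * (s n - 1) := mul_pos (pow_pos (by linarith) _) (by linarith)
      obtain ⟨m', hm'⟩ := hstep m (by linarith)
      refine ⟨m', le_trans ?_ hm'⟩
      rw [pow_succ', mul_assoc]
      exact mul_le_mul_of_nonneg_left hm (by linarith)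
  obtain ⟨j, hj⟩ := pow_unbounded_of_one_lt (M / (s n - 1)) hβ
  rw [div_lt_iff₀ (by linarith)] at hj
  obtain ⟨m, hm⟩ := hiter j
  linarith [hM m]

lemma betaRem_succ_of_lt_one {n : ℕ} (hpos : 0 < s (n + 1)) (hlt : s (n + 1) < 1)
    (hs : s (n + 1) = β * s n - d n) (hr : betaRem β 1 n = s n) :
    betaRem β 1 (n + 1) = s (n + 1) ∧ betaDigit β 1 n = d n := by
  have hfloor : ⌊β * s n⌋ = (d n : ℤ) := by
    rw [Int.floor_eq_iff]
    push_cast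
    constructor <;> linarith
  constructor
  · simp only [betaRem, hr, Int.fract, hfloor, hs, Int.cast_natCast]
  · simp [betaDigit, hr, hfloor]

lemma remainders_periodic (hβ : 1 < β) (hpos : ∀ n, 0 < s n) (hle : ∀ n, s n ≤ 1)
    (hs : ∀ n, s (n + 1) = β * s n - d n) {a b : ℕ} (h : s a = s b) (i : ℕ) :
    s (a + i) = s (b + i) := by
  induction i with
  | zero => exact h
  | succ i ih =>
    have hd : d (a + i) = d (b + i) := le_antisymm (digit_le_of_le hβ hpos hle hs ih.le)
      (digit_le_of_le hβ hpos hle hs ih.ge)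
    rw [← add_assoc, ← add_assoc, hs, hs, ih, hd]

/-- A digit sequence whose remainders all lie in `(0, 1]` is the generating sequence. -/
lemma genSeq_eq_of_remainders (hβ : 1 < β) (h0 : s 0 = 1) (hpos : ∀ n, 0 < s n)
    (hle : ∀ n, s n ≤ 1) (hs : ∀ n, s (n + 1) = β * s n - d n) : genSeq β = d := by
  classical
  by_cases hone : ∃ k, s (k + 1) = 1
  · obtain ⟨k, hk, hmin⟩ : ∃ k, s (k + 1) = 1 ∧ ∀ m < k, s (m + 1) ≠ 1 :=
      ⟨Nat.find hone, Nat.find_spec hone, fun m hm => Nat.find_min hone hm⟩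
    have hrem (n : ℕ) (hn : n ≤ k) : betaRem β 1 n = s n := by
      induction n with
      | zero => simp [betaRem, h0]
      | succ n ih => exact (betaRem_succ_of_lt_one (hpos _) (lt_of_le_of_ne (hle _) (hmin n hn))
          (hs n) (ih (by omega))).1
    have hdigit (n : ℕ) (hn : n < k) : betaDigit β 1 n = d n :=
      (betaRem_succ_of_lt_one (hpos _) (lt_of_le_of_ne (hle _) (hmin n hn)) (hs n)
        (hrem n hn.le)).2
    have hval : β * s k = ((d k + 1 : ℕ) : ℝ) := by push_cast; linarith [hs k]
    have hdigitk : betaDigit β 1 k = d k + 1 := by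
      rw [betaDigit, hrem k le_rfl, hval, Int.floor_natCast, Int.toNat_natCast]
    have hzero (n : ℕ) : betaRem β 1 (k + 1 + n) = 0 := by
      induction n with
      | zero =>
        change Int.fract (β * betaRem β 1 k) = 0
        rw [hrem k le_rfl, hval, Int.fract_natCast]
      | succ n ih =>
        change Int.fract (β * betaRem β 1 (k + 1 + n)) = 0
        rw [ih, mul_zero, Int.fract_zero]
    have hdigit0 (m : ℕ) (hm : k < m) : betaDigit β 1 m = 0 := by
      obtain ⟨n, rfl⟩ := Nat.exists_eq_add_of_le (Nat.succ_le_of_lt hm)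
      simp [betaDigit, hzero n]
    have h : ∃ k, betaDigit β 1 k ≠ 0 ∧ ∀ m, k < m → betaDigit β 1 m = 0 :=
      ⟨k, by omega, hdigit0⟩
    have hfind : Nat.find h = k := by
      obtain ⟨h1, h2⟩ := Nat.find_spec h
      rcases lt_trichotomy (Nat.find h) k with hlt | heq | hgt
      · have := h2 k hlt
        omega
      · exact heq
      · exact absurd (hdigit0 _ hgt) h1
    have hper (n : ℕ) : d (n + (k + 1)) = d n := by
      have hsn : s (k + 1 + n) = s (0 + n) :=
        remainders_periodic hβ hpos hle hs (hk.trans h0.symm) n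
      rw [zero_add, add_comm] at hsn
      exact le_antisymm (digit_le_of_le hβ hpos hle hs hsn.le)
        (digit_le_of_le hβ hpos hle hs hsn.ge)
    have hmod (i : ℕ) : d (i % (k + 1)) = d i := Function.Periodic.map_mod_nat hper i
    funext i
    rw [genSeq, dif_pos h]
    simp only [hfind]
    rw [← hmod i]
    split_ifs with hi
    · rw [hdigitk, hi, Nat.add_sub_cancel]
    · have : i % (k + 1) < k + 1 := Nat.mod_lt i (Nat.succ_pos k)
      exact hdigit _ (by omega)
  · push Not at hone
    have hlt (n : ℕ) : s (n + 1) < 1 := lt_of_le_of_ne (hle _) (hone n)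
    have hrem (n : ℕ) : betaRem β 1 n = s n := by
      induction n with
      | zero => simp [betaRem, h0]
      | succ n ih => exact (betaRem_succ_of_lt_one (hpos _) (hlt n) (hs n) ih).1
    have hdigit : betaDigit β 1 = d :=
      funext fun n => (betaRem_succ_of_lt_one (hpos _) (hlt n) (hs n) (hrem n)).2
    rw [genSeq, dif_neg, hdigit]
    rintro ⟨k, -, hk⟩
    obtain ⟨n, hn, hne⟩ := exists_digit_ne_zero hβ hpos hle hs (k + 1)
    exact hne (hdigit ▸ hk n hn)

end QuasiGreedy

lemma exists_remainders {β : ℝ} (hβ : 1 < β) :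
    ∃ (s : ℕ → ℝ) (d : ℕ → ℕ), s 0 = 1 ∧ (∀ n, 0 < s n) ∧ (∀ n, s n ≤ 1) ∧
      ∀ n, s (n + 1) = β * s n - d n := by
  let s : ℕ → ℝ := fun n => Nat.rec 1 (fun _ r => β * r - (⌈β * r⌉ - 1)) n
  have hsucc (n : ℕ) : s (n + 1) = β * s n - (⌈β * s n⌉ - 1) := rfl
  have hpos (n : ℕ) : 0 < s n := by
    cases n with
    | zero => exact one_pos
    | succ n => rw [hsucc]; linarith [Int.ceil_lt_add_one (β * s n)]
  have hle (n : ℕ) : s n ≤ 1 := by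
    cases n with
    | zero => exact le_rfl
    | succ n => rw [hsucc]; linarith [Int.le_ceil (β * s n)]
  refine ⟨s, fun n => (⌈β * s n⌉ - 1).toNat, rfl, hpos, hle, fun n => ?_⟩
  have hceil : 0 < ⌈β * s n⌉ := Int.ceil_pos.mpr (mul_pos (by linarith) (hpos n))
  have hcast : (((⌈β * s n⌉ - 1).toNat : ℤ) : ℝ) = ⌈β * s n⌉ - 1 := by
    rw [Int.toNat_of_nonneg (by omega)]; push_cast; rfl
  rw [hsucc, ← hcast, Int.cast_natCast]

section Phi

lemma blockStart_succ' (x : ℕ → ℕ) (i : ℕ) :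
    blockStart x (i + 1) = x 0 + 1 + blockStart (fun n => x (n + 1)) i := by
  simp only [blockStart, Finset.sum_range_succ', add_comm]

lemma phi_of_lt (x : ℕ → ℕ) {m : ℕ} (hm : m < x 0) : phi x m = 1 := by
  rw [phi, if_neg]
  rintro ⟨i, hi⟩
  cases i with
  | zero => simp [blockStart] at hi; omega
  | succ i => rw [blockStart_succ'] at hi; omega

lemma phi_head (x : ℕ → ℕ) : phi x (x 0) = 0 :=
  if_pos ⟨0, by simp [blockStart]⟩

lemma phi_tail (x : ℕ → ℕ) (m : ℕ) : phi x (x 0 + 1 + m) = phi (fun n => x (n + 1)) m := by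
  have h : (∃ i, blockStart x i + x i = x 0 + 1 + m) ↔
      ∃ i, blockStart (fun n => x (n + 1)) i + x (i + 1) = m := by
    constructor
    · rintro ⟨i, hi⟩
      cases i with
      | zero => simp [blockStart] at hi; omega
      | succ i => exact ⟨i, by rw [blockStart_succ'] at hi; omega⟩
    · rintro ⟨i, hi⟩
      exact ⟨i + 1, by rw [blockStart_succ']; omega⟩
  classical exact if_congr h rfl rfl

lemma phi_le_one (x : ℕ → ℕ) (m : ℕ) : phi x m ≤ 1 := by
  rw [phi]; split_ifs <;> omega

lemma phi_lexLt {x y : ℕ → ℕ} (h : lexLt x y) : lexLt (phi x) (phi y) := by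
  obtain ⟨n, heq, hlt⟩ := h
  induction n generalizing x y with
  | zero =>
    refine ⟨x 0, fun i hi => ?_, ?_⟩
    · rw [phi_of_lt x hi, phi_of_lt y (hi.trans hlt)]
    · rw [phi_head, phi_of_lt y hlt]; exact one_pos
  | succ n ih =>
    obtain ⟨m, hm, hmlt⟩ := ih (x := fun n => x (n + 1)) (y := fun n => y (n + 1))
      (fun i hi => heq (i + 1) (by omega)) hlt
    have h0 : x 0 = y 0 := heq 0 (Nat.succ_pos n)
    refine ⟨x 0 + 1 + m, fun i hi => ?_, ?_⟩
    · rcases lt_trichotomy i (x 0) with hi0 | rfl | hi0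
      · rw [phi_of_lt x hi0, phi_of_lt y (h0 ▸ hi0)]
      · rw [phi_head, h0, phi_head]
      · obtain ⟨j, rfl⟩ := Nat.exists_eq_add_of_le (Nat.succ_le_of_lt hi0)
        rw [Nat.succ_eq_add_one, phi_tail, h0, phi_tail]
        exact hm j (by omega)
    · rw [phi_tail, h0, phi_tail]
      exact hmlt

lemma phi_lexLe {x y : ℕ → ℕ} (h : lexLe x y) : lexLe (phi x) (phi y) :=
  h.imp (congrArg _) phi_lexLt

lemma lexLe_trans {x y z : ℕ → ℕ} (hxy : lexLe x y) (hyz : lexLe y z) : lexLe x z := by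
  rcases hxy with rfl | ⟨n, hn, hlt⟩
  · exact hyz
  rcases hyz with rfl | ⟨m, hm, hlt'⟩
  · exact Or.inr ⟨n, hn, hlt⟩
  refine Or.inr ⟨min n m, fun i hi => ?_, ?_⟩
  · rw [hn i (by omega), hm i (by omega)]
  · rcases lt_trichotomy n m with h | rfl | h
    · rw [min_eq_left h.le, ← hm n h]; exact hlt
    · rw [min_self]; exact hlt.trans hlt'
    · rw [min_eq_right h.le, hn m h]; exact hlt'

/-- A shift of `φ(x)` is `φ` of a shift of `x` whose first entry may have been decreased. -/
lemma exists_phi_eq_shift (x : ℕ → ℕ) (k : ℕ) :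
    ∃ (z : ℕ → ℕ) (n : ℕ), (fun m => phi x (k + m)) = phi z ∧ z 0 ≤ x n ∧
      ∀ i, z (i + 1) = x (n + (i + 1)) := by
  induction k using Nat.strong_induction_on generalizing x with
  | _ k ih =>
    rcases le_or_gt k (x 0) with hk | hk
    · let z : ℕ → ℕ := fun i => Nat.casesOn i (x 0 - k) fun i => x (i + 1)
      have hz0 : z 0 = x 0 - k := rfl
      have hz (i : ℕ) : z (i + 1) = x (i + 1) := rfl
      refine ⟨z, 0, funext fun m => ?_, by omega, fun i => by rw [hz, zero_add]⟩
      rcases lt_trichotomy m (z 0) with hm | rfl | hm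
      · rw [phi_of_lt z hm, phi_of_lt x (by omega)]
      · rw [phi_head, show k + z 0 = x 0 by omega, phi_head]
      · obtain ⟨j, rfl⟩ := Nat.exists_eq_add_of_le (Nat.succ_le_of_lt hm)
        rw [Nat.succ_eq_add_one, phi_tail, show k + (z 0 + 1 + j) = x 0 + 1 + j by omega, phi_tail]
    · obtain ⟨j, rfl⟩ := Nat.exists_eq_add_of_le (Nat.succ_le_of_lt hk)
      obtain ⟨z, n, hphi, h0, hz⟩ := ih j (by omega) fun n => x (n + 1)
      refine ⟨z, n + 1, ?_, h0, fun i => ?_⟩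
      · rw [← hphi]
        funext m
        rw [Nat.succ_eq_add_one, add_assoc (x 0 + 1), phi_tail]
      · rw [hz, add_right_comm n 1]

lemma lexLe_phi_shift {x : ℕ → ℕ} (h : ∀ k, lexLe (fun n => x (k + n)) x) (k : ℕ) :
    lexLe (fun n => phi x (k + n)) (phi x) := by
  obtain ⟨z, n, hphi, h0, hz⟩ := exists_phi_eq_shift x k
  rw [hphi]
  refine phi_lexLe (lexLe_trans ?_ (h n))
  rcases h0.eq_or_lt with heq | hlt
  · left
    funext i
    cases i with
    | zero => exact heq
    | succ i => exact hz i
  · exact Or.inr ⟨0, by simp, hlt⟩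

lemma exists_phi_eq_one {x : ℕ → ℕ} (h : ∀ N, ∃ n ≥ N, x n ≠ 0) (N : ℕ) :
    ∃ m ≥ N, phi x m = 1 := by
  have hmono : StrictMono (blockStart x) := strictMono_nat_of_lt_succ fun n => by
    simp only [blockStart, Finset.sum_range_succ]; omega
  obtain ⟨n, hn, hne⟩ := h N
  refine ⟨blockStart x n, hn.trans hmono.le_apply, if_neg ?_⟩
  rintro ⟨i, hi⟩
  rcases lt_trichotomy i n with hin | rfl | hin
  · have := hmono.monotone (Nat.succ_le_of_lt hin)
    simp only [Nat.succ_eq_add_one, blockStart, Finset.sum_range_succ] at this hi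
    omega
  · omega
  · have := hmono hin
    omega

end Phi

section Parry

variable {d : ℕ → ℕ}

lemma summable_digit_mul_pow (hd : ∀ n, d n ≤ 1) {x : ℝ} (hx0 : 0 ≤ x) (hx1 : x < 1) (n : ℕ) :
    Summable fun i => (d (n + i) : ℝ) * x ^ (i + 1) := by
  refine Summable.of_nonneg_of_le (fun i => by positivity) (fun i => ?_)
    ((summable_geometric_of_lt_one hx0 hx1).mul_left x)
  rw [← pow_succ']
  exact mul_le_of_le_one_left (by positivity) (by exact_mod_cast hd _)

lemma exists_tsum_digit_eq_one (hd : ∀ n, d n ≤ 1) (h0 : d 0 = 1) (hone : ∃ n ≥ 1, d n = 1)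
    (hzero : ∃ n, d n = 0) :
    ∃ x : ℝ, 1 / 2 < x ∧ x < 1 ∧ ∑' i, (d i : ℝ) * x ^ (i + 1) = 1 := by
  obtain ⟨k, hk1, hk⟩ := hone
  obtain ⟨l, hl⟩ := hzero
  have hsum {x : ℝ} (hx0 : 0 ≤ x) (hx1 : x < 1) :
      Summable fun i => (d i : ℝ) * x ^ (i + 1) := by
    simpa using summable_digit_mul_pow hd hx0 hx1 0
  set F : ℝ → ℝ := fun x => ∑' i, (d i : ℝ) * x ^ (i + 1)
  set c : ℝ := 1 - 1 / (k + 2) with hc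
  have hk' : (1 : ℝ) ≤ k := by exact_mod_cast hk1
  have hε : (1 : ℝ) / (k + 2) ≤ 1 / 2 := one_div_le_one_div_of_le (by norm_num) (by linarith)
  have hε0 : (0 : ℝ) < 1 / (k + 2) := by positivity
  have hc2 : 1 / 2 ≤ c := by linarith
  have hc1 : c < 1 := by linarith
  have hcont : ContinuousOn F (Set.Icc (1 / 2) c) := by
    refine continuousOn_tsum (u := fun i => c * c ^ i) (fun i => by fun_prop)
      ((summable_geometric_of_lt_one (by linarith) hc1).mul_left c) fun i x hx => ?_
    have hx0 : 0 ≤ x := by linarith [hx.1]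
    rw [Real.norm_of_nonneg (by positivity), ← pow_succ']
    exact (mul_le_of_le_one_left (by positivity) (by exact_mod_cast hd _)).trans
      (pow_le_pow_left₀ hx0 hx.2 _)
  have hhalf : F (1 / 2) < 1 := by
    have hgeom : HasSum (fun i : ℕ => (1 / 2 : ℝ) ^ (i + 1)) 1 := by
      have := hasSum_geometric_two.mul_left (1 / 2 : ℝ)
      simpa only [← pow_succ', one_div, inv_mul_cancel₀ (two_ne_zero' ℝ)] using this
    refine lt_of_lt_of_eq (Summable.tsum_lt_tsum (i := l) (fun i => ?_) ?_
      (hsum (by norm_num) (by norm_num)) hgeom.summable) hgeom.tsum_eq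
    · exact mul_le_of_le_one_left (by positivity) (Nat.cast_le_one.mpr (hd i))
    · rw [hl]; simp
  have hFc : 1 ≤ F c := by
    have hle := (hsum (by linarith) hc1).sum_le_tsum {0, k} fun i _ => by
      have : 0 ≤ c := by linarith
      positivity
    rw [Finset.sum_pair (by omega), h0, hk] at hle
    have hbern := one_add_mul_le_pow (a := -(1 / ((k : ℝ) + 2))) (by linarith) (k + 1)
    have hfrac : ((k : ℝ) + 2) * (1 / (k + 2)) = 1 := by field_simp
    rw [← sub_eq_add_neg, ← hc] at hbern
    push_cast at hbern hle
    refine le_trans ?_ hle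
    simp only [one_mul, pow_one]
    linarith
  obtain ⟨x, hx, hFx⟩ := intermediate_value_Icc hc2 hcont ⟨hhalf.le, hFc⟩
  refine ⟨x, lt_of_le_of_ne hx.1 ?_, hx.2.trans_lt hc1, hFx⟩
  rintro rfl
  exact hhalf.ne hFx

/-- A shift-maximal `0`-`1` sequence which is not constant and not eventually zero is a
generating sequence. -/
lemma exists_genSeq_eq (hd : ∀ n, d n ≤ 1) (h0 : d 0 = 1) (hone : ∀ N, ∃ n ≥ N, d n = 1)
    (hzero : ∃ n, d n = 0) (hlex : ∀ k, lexLe (fun n => d (k + n)) d) :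
    ∃ β : ℝ, 1 < β ∧ β < 2 ∧ genSeq β = d := by
  obtain ⟨x, hx2, hx1, hx⟩ := exists_tsum_digit_eq_one hd h0 (hone 1) hzero
  have hx0 : 0 < x := by linarith
  have hβ : 1 < x⁻¹ := (one_lt_inv₀ hx0).mpr hx1
  have hsum (n : ℕ) := summable_digit_mul_pow hd hx0.le hx1 n
  set s : ℕ → ℝ := fun n => ∑' i, (d (n + i) : ℝ) * x ^ (i + 1) with hs_def
  have hs0 : s 0 = 1 := by simpa [hs_def] using hx
  have hpos (n : ℕ) : 0 < s n := by
    obtain ⟨m, hm, hdm⟩ := hone n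
    refine (hsum n).tsum_pos (fun i => by positivity) (m - n) ?_
    rw [Nat.add_sub_cancel' hm, hdm]
    positivity
  have hs (n : ℕ) : s (n + 1) = x⁻¹ * s n - d n := by
    have hsplit : s n = d n * x + x * s (n + 1) := by
      simp only [hs_def]
      rw [(hsum n).tsum_eq_zero_add, ← tsum_mul_left]
      congr 1
      · simp
      · refine tsum_congr fun i => ?_
        rw [show n + (i + 1) = n + 1 + i by omega, pow_succ' x (i + 1)]
        ring
    rw [hsplit]
    field_simp
    ring
  have hM (n : ℕ) : s n ≤ ∑' i, x * x ^ i := by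
    refine (hsum n).tsum_le_tsum (fun i => ?_)
      ((summable_geometric_of_lt_one hx0.le hx1).mul_left x)
    rw [← pow_succ']
    exact mul_le_of_le_one_left (by positivity) (by exact_mod_cast hd _)
  refine ⟨x⁻¹, hβ, (inv_lt_comm₀ hx0 two_pos).mpr (by linarith), ?_⟩
  exact genSeq_eq_of_remainders hβ hs0 hpos
    (remainder_le_one hβ hs0 (fun n => (hpos n).le) hM hs hlex) hs

end Parry

/-- for every `β > 1` there exists `1 < β' < 2` with
`g(β') = φ(g(β)) = 1^{g_1}0 · 1^{g_2}0 · 1^{g_3}0 ⋯`. -/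
theorem statement19 (β : ℝ) (hβ : 1 < β) :
    ∃ β' : ℝ, 1 < β' ∧ β' < 2 ∧ genSeq β' = phi (genSeq β) := by
  obtain ⟨s, d, h0, hpos, hle, hs⟩ := exists_remainders hβ
  rw [genSeq_eq_of_remainders hβ h0 hpos hle hs]
  have hd0 : 0 < d 0 := by
    have h1 := hs 0
    rw [h0] at h1
    have : (0 : ℝ) < d 0 := by linarith [hle 1]
    exact_mod_cast this
  exact exists_genSeq_eq (phi_le_one d) (phi_of_lt d hd0)
    (exists_phi_eq_one (exists_digit_ne_zero hβ hpos hle hs)) ⟨d 0, phi_head d⟩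
    (lexLe_phi_shift (lexLe_shift_of_remainders hβ h0 hpos hle hs))
end
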